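/- Let D ⊂ ℂ be a Jordan domain and let z ∈ D, with d := dist(z, ∂D) the Euclidean distance from z to the boundary of D. Then: (i) every holomorphic function f on D with ∫_D |f|² dA ≤ 1 satisfies |f(z)|² ≤ 1/(π d²); and (ii) there exists a holomorphic function f on D with ∫_D |f|² dA ≤ 1 and |f(z)|² ≥ 1/(16 π d²). Equivalently, the diagonal K(z,z) := sup{ |f(z)|² : f holomorphic on D, ∫_D |f|² dA ≤ 1 } of the Bergman kernel satisfies 1/(16π d²) ≤ K(z,z) ≤ 1/(π d²). -/

import Mathlib

open MeasureTheory Filter Polynomial Set Metric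

noncomputable section

/-- A Jordan curve: the range of an injective continuous map from the unit circle into `ℂ`. -/
def IsJordanCurve (C : Set ℂ) : Prop :=
  ∃ f : ℂ → ℂ, ContinuousOn f (sphere (0:ℂ) 1) ∧ InjOn f (sphere (0:ℂ) 1) ∧
    C = f '' sphere (0:ℂ) 1

/-- A Jordan domain: the bounded connected component of the complement of a Jordan curve. -/
def IsJordanDomain (D : Set ℂ) : Prop :=
  ∃ C : Set ℂ, IsJordanCurve C ∧ Bornology.IsBounded D ∧
    ∃ z ∈ Cᶜ, D = connectedComponentIn Cᶜ z

/-- An archipelago: a finite family of Jordan domains with mutually disjoint closures. -/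
def IsArchipelago {N : ℕ} (Gs : Fin N → Set ℂ) : Prop :=
  (∀ j, IsJordanDomain (Gs j)) ∧
  ∀ j k, j ≠ k → Disjoint (closure (Gs j)) (closure (Gs k))

/-- `P n` is the Bergman orthonormal polynomial of degree `n` for `G`, with positive real
leading coefficient `lam n`, and the family is orthonormal in `L²(G, dA)`. -/
def IsBergmanSystem (G : Set ℂ) (P : ℕ → Polynomial ℂ) (lam : ℕ → ℝ) : Prop :=
  (∀ n, (P n).natDegree = n) ∧
  (∀ n, 0 < lam n ∧ (P n).leadingCoeff = (lam n : ℂ)) ∧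
  ∀ n k, (∫ z in G, (P n).eval z * (starRingEnd ℂ) ((P k).eval z)) =
    if n = k then 1 else 0

open scoped Topology

lemma setLIntegral_enorm_sq_ball_ge {f : ℂ → ℂ} {z : ℂ} {r : ℝ} (hr : 0 < r)
    (hf : DifferentiableOn ℂ f (ball z r)) :
    ENNReal.ofReal (Real.pi * r ^ 2) * ‖f z‖ₑ ^ 2 ≤ ∫⁻ w in ball z r, ‖f w‖ₑ ^ 2 := by
  have circle_bound : ∀ ρ ∈ Ioo 0 r, ENNReal.ofReal (2 * Real.pi) * ‖f z‖ₑ ^ 2 ≤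
      ∫⁻ θ in Ioo (-Real.pi) Real.pi, ‖f (z + ρ * (Real.cos θ + Real.sin θ * Complex.I))‖ₑ ^ 2 := by
    intro ρ hρ
    have hsub : closedBall z |ρ| ⊆ ball z r := by
      rw [abs_of_pos hρ.1]; exact closedBall_subset_ball hρ.2
    have hav : Real.circleAverage (fun w ↦ f w ^ 2) z ρ = f z ^ 2 := by
      refine DiffContOnCl.circleAverage (f := fun w ↦ f w ^ 2) ?_
      exact ((hf.pow 2).mono hsub).diffContOnCl_ball subset_rfl
    have hper : Function.Periodic (fun θ : ℝ ↦ f (circleMap z ρ θ) ^ 2) (2 * Real.pi) := by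
      intro θ; simp only [periodic_circleMap z ρ θ]
    have hint : ∫ θ in Ioo (-Real.pi) Real.pi, f (circleMap z ρ θ) ^ 2 =
        (2 * Real.pi : ℝ) • f z ^ 2 := by
      rw [← hav, Real.circleAverage_def, smul_inv_smul₀ (by positivity)]
      have := hper.intervalIntegral_add_eq (-Real.pi) 0
      rw [show -Real.pi + 2 * Real.pi = Real.pi by ring, zero_add] at this
      rw [← this, intervalIntegral.integral_of_le (by linarith [Real.pi_pos]),
        integral_Ioc_eq_integral_Ioo]
    calc ENNReal.ofReal (2 * Real.pi) * ‖f z‖ₑ ^ 2 = ‖(2 * Real.pi : ℝ) • f z ^ 2‖ₑ := by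
          rw [enorm_smul, enorm_pow, Real.enorm_eq_ofReal (by positivity)]
      _ ≤ ∫⁻ θ in Ioo (-Real.pi) Real.pi, ‖f (circleMap z ρ θ) ^ 2‖ₑ := by
          rw [← hint]; exact enorm_integral_le_lintegral_enorm _
      _ = _ := by
          refine lintegral_congr fun θ ↦ ?_
          rw [enorm_pow, circleMap, Complex.exp_mul_I, Complex.ofReal_cos, Complex.ofReal_sin]
  have htrans : ∫⁻ w in ball z r, ‖f w‖ₑ ^ 2 =
      ∫⁻ w, (ball (0 : ℂ) r).indicator (fun w ↦ ‖f (z + w)‖ₑ ^ 2) w := by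
    rw [← lintegral_indicator measurableSet_ball, ← lintegral_add_left_eq_self _ z]
    refine lintegral_congr fun w ↦ ?_
    simp [indicator]
  have hmeas : Measurable ((ball (0 : ℂ) r).indicator (fun w ↦ ‖f (z + w)‖ₑ ^ 2)) := by
    have hc : ContinuousOn (fun w ↦ ‖f (z + w)‖ₑ ^ 2) (ball (0 : ℂ) r) := by
      refine (ENNReal.continuous_pow 2).comp_continuousOn
        (continuous_enorm.comp_continuousOn (hf.continuousOn.comp (by fun_prop) ?_))
      intro w hw; simpa [mem_ball_iff_norm] using hw
    classical
    have := hc.measurable_piecewise (g := fun _ ↦ (0 : ENNReal)) continuousOn_const measurableSet_ball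
    simpa [Set.piecewise_eq_indicator] using! this
  rw [htrans, ← Complex.lintegral_comp_polarCoord_symm, polarCoord_target,
    Measure.volume_eq_prod, ← Measure.prod_restrict, lintegral_prod]
  · calc ENNReal.ofReal (Real.pi * r ^ 2) * ‖f z‖ₑ ^ 2
        ≤ ∫⁻ ρ in Ioo 0 r, ENNReal.ofReal ρ * (ENNReal.ofReal (2 * Real.pi) * ‖f z‖ₑ ^ 2) := by
          rw [lintegral_mul_const _ (by fun_prop), ← mul_assoc]
          gcongr
          rw [← ofReal_integral_eq_lintegral_ofReal, ← integral_Ioc_eq_integral_Ioo,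
            ← intervalIntegral.integral_of_le hr.le, integral_id, ← ENNReal.ofReal_mul]
          · apply le_of_eq; congr 1; ring
          · simp only [ne_eq, OfNat.ofNat_ne_zero, not_false_eq_true, zero_pow, sub_zero]
            positivity
          · exact (continuous_id.integrableOn_Icc (a := 0) (b := r)).mono_set Ioo_subset_Icc_self
          · filter_upwards [ae_restrict_mem measurableSet_Ioo] with ρ hρ using hρ.1.le
      _ ≤ ∫⁻ ρ in Ioo 0 r, ∫⁻ θ in Ioo (-Real.pi) Real.pi, ENNReal.ofReal ρ •
            (ball (0 : ℂ) r).indicator (fun w ↦ ‖f (z + w)‖ₑ ^ 2)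
              (Complex.polarCoord.symm (ρ, θ)) := by
          refine setLIntegral_mono' measurableSet_Ioo fun ρ hρ ↦ ?_
          simp only [smul_eq_mul]
          rw [lintegral_const_mul' _ _ ENNReal.ofReal_ne_top]
          gcongr
          refine (circle_bound ρ hρ).trans_eq (lintegral_congr fun θ ↦ ?_)
          rw [indicator_of_mem]
          · simp
          · rw [mem_ball_zero_iff, Complex.norm_polarCoord_symm, abs_of_pos hρ.1]
            exact hρ.2
      _ ≤ _ := lintegral_mono_set Ioo_subset_Ioi_self
  · refine Measurable.aemeasurable ?_
    have : Measurable fun p : ℝ × ℝ ↦ Complex.polarCoord.symm p := by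
      simp only [Complex.polarCoord_symm_apply]
      fun_prop
    exact (measurable_fst.ennreal_ofReal).smul (hmeas.comp this)

lemma closure_connectedComponentIn_compl_subset {C : Set ℂ} (hC : IsClosed C) (x : ℂ) :
    closure (connectedComponentIn Cᶜ x) ⊆ connectedComponentIn Cᶜ x ∪ C := by
  intro y hy
  by_contra hcon
  rw [mem_union, not_or] at hcon
  obtain ⟨hy1, hy2⟩ := hcon
  have hopen : IsOpen (connectedComponentIn Cᶜ y) := hC.isOpen_compl.connectedComponentIn
  obtain ⟨w, hw1, hw2⟩ := mem_closure_iff.1 hy _ hopen (mem_connectedComponentIn hy2)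
  have := (connectedComponentIn_eq hw1).trans (connectedComponentIn_eq hw2).symm
  exact hy1 (this ▸ mem_connectedComponentIn hy2)

lemma isConnected_compl_connectedComponentIn_compl {C : Set ℂ} (hC : IsClosed C)
    (hconn : IsConnected C) (x : ℂ) : IsConnected (connectedComponentIn Cᶜ x)ᶜ := by
  have hsub : C ⊆ (connectedComponentIn Cᶜ x)ᶜ :=
    subset_compl_comm.1 (connectedComponentIn_subset _ _)
  obtain ⟨c, hc⟩ := hconn.nonempty
  refine ⟨⟨c, hsub hc⟩, isPreconnected_of_forall c fun y hy ↦ ?_⟩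
  by_cases hyC : y ∈ C
  · exact ⟨C, hsub, hc, hyC, hconn.isPreconnected⟩
  have hdisj : connectedComponentIn Cᶜ y ⊆ (connectedComponentIn Cᶜ x)ᶜ := by
    intro w hw hwx
    have := (connectedComponentIn_eq hw).trans (connectedComponentIn_eq hwx).symm
    exact hy (this ▸ mem_connectedComponentIn hyC)
  have hcl := closure_connectedComponentIn_compl_subset hC y
  refine ⟨closure (connectedComponentIn Cᶜ y) ∪ C,
    union_subset (hcl.trans (union_subset hdisj hsub)) hsub, Or.inr hc,
    Or.inl (subset_closure (mem_connectedComponentIn hyC)), ?_⟩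
  have hpre : IsPreconnected (closure (connectedComponentIn Cᶜ y)) :=
    isPreconnected_connectedComponentIn.closure
  suffices ∃ w ∈ closure (connectedComponentIn Cᶜ y), w ∈ C by
    obtain ⟨w, hw1, hw2⟩ := this
    exact hpre.union w hw1 hw2 hconn.isPreconnected
  by_contra! hno
  have hclosed : IsClosed (connectedComponentIn Cᶜ y) := by
    refine isClosed_of_closure_subset fun w hw ↦ (hcl hw).resolve_right (hno w hw)
  have hopen : IsOpen (connectedComponentIn Cᶜ y) := hC.isOpen_compl.connectedComponentIn
  have huniv := IsClopen.eq_univ ⟨hclosed, hopen⟩ ⟨y, mem_connectedComponentIn hyC⟩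
  have hcC : c ∈ Cᶜ := connectedComponentIn_subset Cᶜ y (huniv ▸ mem_univ c)
  exact hcC hc

lemma IsJordanCurve.isCompact {C : Set ℂ} (hC : IsJordanCurve C) : IsCompact C := by
  obtain ⟨f, hf, -, rfl⟩ := hC
  exact (isCompact_sphere 0 1).image_of_continuousOn hf

lemma IsJordanCurve.isConnected {C : Set ℂ} (hC : IsJordanCurve C) : IsConnected C := by
  obtain ⟨f, hf, -, rfl⟩ := hC
  refine (isConnected_sphere ?_ 0 zero_le_one).image f hf
  simp [← Module.finrank_eq_rank, Complex.finrank_real_complex]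

lemma IsJordanDomain.isOpen {D : Set ℂ} (hD : IsJordanDomain D) : IsOpen D := by
  obtain ⟨C, hC, -, z, -, rfl⟩ := hD
  exact hC.isCompact.isClosed.isOpen_compl.connectedComponentIn

lemma IsJordanDomain.isBounded {D : Set ℂ} (hD : IsJordanDomain D) : Bornology.IsBounded D := by
  obtain ⟨C, -, h, -⟩ := hD
  exact h

lemma IsJordanDomain.isConnected_compl {D : Set ℂ} (hD : IsJordanDomain D) :
    IsConnected Dᶜ := by
  obtain ⟨C, hC, -, z, -, rfl⟩ := hD
  exact isConnected_compl_connectedComponentIn_compl hC.isCompact.isClosed hC.isConnected z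

/-- The reciprocals of the points outside `D`, together with `0`. -/
def reciprocalCompl (D : Set ℂ) : Set ℂ := {ζ | ∀ w ∈ D, 1 - ζ * w ≠ 0}

lemma zero_mem_reciprocalCompl (D : Set ℂ) : 0 ∈ reciprocalCompl D := by
  simp [reciprocalCompl]

lemma inv_mem_reciprocalCompl {D : Set ℂ} {a : ℂ} (ha0 : a ≠ 0) (ha : a ∉ D) :
    a⁻¹ ∈ reciprocalCompl D := by
  intro w hw h
  have : w = a := by field_simp at h; linear_combination -h
  exact ha (this ▸ hw)

lemma inv_notMem_of_mem_reciprocalCompl {D : Set ℂ} {ζ : ℂ} (h : ζ ∈ reciprocalCompl D)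
    (h0 : ζ ≠ 0) : ζ⁻¹ ∉ D := fun hD ↦ h _ hD (by simp [h0])

lemma norm_mul_le_one_of_mem_reciprocalCompl {D : Set ℂ} {r : ℝ}
    (hD : ball (0 : ℂ) r ⊆ D) {ζ : ℂ} (h : ζ ∈ reciprocalCompl D) : ‖ζ‖ * r ≤ 1 := by
  rcases eq_or_ne ζ 0 with rfl | h0
  · simp
  have := mt (@hD ζ⁻¹) (inv_notMem_of_mem_reciprocalCompl h h0)
  rw [mem_ball_zero_iff, not_lt, norm_inv] at this
  have hp : 0 < ‖ζ‖ := norm_pos_iff.2 h0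
  calc ‖ζ‖ * r ≤ ‖ζ‖ * ‖ζ‖⁻¹ := by gcongr
    _ = 1 := mul_inv_cancel₀ hp.ne'

lemma isClosed_reciprocalCompl {D : Set ℂ} (hD : IsOpen D) : IsClosed (reciprocalCompl D) := by
  rw [← isOpen_compl_iff, isOpen_iff_mem_nhds]
  intro ζ hζ
  simp only [reciprocalCompl, mem_compl_iff, mem_ofPred_eq, not_forall, not_not] at hζ
  obtain ⟨w, hw, hw1⟩ := hζ
  have hζ0 : ζ ≠ 0 := by rintro rfl; simp at hw1
  have hw' : ζ⁻¹ = w := by field_simp; linear_combination hw1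
  filter_upwards [(continuousAt_inv₀ hζ0).preimage_mem_nhds (hD.mem_nhds (hw' ▸ hw)),
    isOpen_ne.mem_nhds hζ0] with ξ h1 h2 h3
  exact inv_notMem_of_mem_reciprocalCompl h3 h2 h1

lemma isCompact_reciprocalCompl {D : Set ℂ} (hD : IsOpen D) (h0 : 0 ∈ D) :
    IsCompact (reciprocalCompl D) := by
  obtain ⟨r, hr, hrD⟩ := Metric.isOpen_iff.1 hD 0 h0
  refine (isCompact_closedBall (0 : ℂ) (1 / r)).of_isClosed_subset (isClosed_reciprocalCompl hD) ?_
  intro ζ hζ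
  rw [mem_closedBall_zero_iff, le_div_iff₀ hr]
  exact norm_mul_le_one_of_mem_reciprocalCompl hrD hζ

lemma isConnected_reciprocalCompl {D : Set ℂ} (hb : Bornology.IsBounded D)
    (hD : IsConnected Dᶜ) (h0 : 0 ∈ D) : IsConnected (reciprocalCompl D) := by
  have hne : ∀ w ∈ Dᶜ, w ≠ 0 := fun w hw h ↦ hw (h ▸ h0)
  have himg : IsConnected ((·⁻¹) '' Dᶜ) :=
    hD.image _ (continuousOn_inv₀.mono fun w hw ↦ hne w hw)
  have hsub : (·⁻¹) '' Dᶜ ⊆ reciprocalCompl D := by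
    rintro _ ⟨w, hw, rfl⟩; exact inv_mem_reciprocalCompl (hne w hw) hw
  refine himg.subset_closure hsub fun ζ hζ ↦ ?_
  rcases eq_or_ne ζ 0 with rfl | hζ0
  · have : Dᶜ ∈ Bornology.cobounded ℂ := by simpa [Bornology.isBounded_def] using hb
    refine mem_closure_of_tendsto (tendsto_inv₀_cobounded (α := ℂ)) ?_
    filter_upwards [this] with w hw using mem_image_of_mem _ hw
  · exact subset_closure ⟨ζ⁻¹, inv_notMem_of_mem_reciprocalCompl hζ hζ0, inv_inv ζ⟩

lemma lintegral_enorm_deriv_sq_eq_volume_image {F : ℂ → ℂ} {A : Set ℂ} (hA : MeasurableSet A)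
    (hF : ∀ w ∈ A, DifferentiableAt ℂ F w) (hinj : InjOn F A) :
    ∫⁻ w in A, ‖deriv F w‖ₑ ^ 2 = volume (F '' A) := by
  rw [← lintegral_abs_det_fderiv_eq_addHaar_image volume hA
    (fun w hw ↦ ((hF w hw).hasDerivAt.hasFDerivAt.restrictScalars ℝ).hasFDerivWithinAt) hinj]
  refine lintegral_congr fun w ↦ ?_
  have : ((ContinuousLinearMap.toSpanSingleton ℂ (deriv F w)).restrictScalars ℝ).det =
      ‖deriv F w‖ ^ 2 := by
    simp [ContinuousLinearMap.det, LinearMap.det_restrictScalars, Algebra.norm_complex_apply,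
      Complex.normSq_eq_norm_sq]
  rw [this, abs_of_nonneg (by positivity), ENNReal.ofReal_pow (norm_nonneg _), ofReal_norm]

lemma exists_measurable_partition_injOn {F : ℂ → ℂ} {W : Set ℂ} (hW : IsOpen W)
    (hF : DifferentiableOn ℂ F W) (hF' : ∀ w ∈ W, deriv F w ≠ 0) :
    ∃ A : ℕ → Set ℂ, (∀ i, MeasurableSet (A i)) ∧ Pairwise (Function.onFun Disjoint A) ∧
      (∀ i, InjOn F (A i)) ∧ ⋃ i, A i = W := by
  have hloc : ∀ w ∈ W, ∃ V : Set ℂ, IsOpen V ∧ w ∈ V ∧ InjOn F V := by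
    intro w hw
    have hs : HasStrictDerivAt F (deriv F w) w :=
      (hF.analyticAt (hW.mem_nhds hw)).hasStrictDerivAt
    obtain ⟨V, hV, hwV, h⟩ : ∃ V, IsOpen V ∧ w ∈ V ∧ InjOn F V := by
      have hs' := hs.hasStrictFDerivAt_equiv (hF' w hw)
      exact ⟨_, (hs'.toOpenPartialHomeomorph F).open_source,
        hs'.mem_toOpenPartialHomeomorph_source, (hs'.toOpenPartialHomeomorph F).injOn⟩
    exact ⟨V, hV, hwV, h⟩
  choose! V hVo hVm hVi using hloc
  obtain ⟨T, hTW, hTc, hTcov⟩ := TopologicalSpace.countable_cover_nhdsWithin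
    (fun w hw ↦ mem_nhdsWithin_of_mem_nhds ((hVo w hw).mem_nhds (hVm w hw)) : ∀ w ∈ W, V w ∈ 𝓝[W] w)
  have hex : ∃ B : ℕ → Set ℂ, (∀ i, IsOpen (B i)) ∧ (∀ i, InjOn F (B i)) ∧ W ⊆ ⋃ i, B i := by
    rcases T.eq_empty_or_nonempty with rfl | hne
    · exact ⟨fun _ ↦ ∅, by simp, by simp, by simpa using hTcov⟩
    · obtain ⟨t, rfl⟩ := hTc.exists_eq_range hne
      refine ⟨fun i ↦ V (t i), fun i ↦ hVo _ (hTW ⟨i, rfl⟩), fun i ↦ hVi _ (hTW ⟨i, rfl⟩), ?_⟩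
      simpa using hTcov
  obtain ⟨B, hBo, hBi, hBW⟩ := hex
  refine ⟨fun i ↦ W ∩ disjointed B i, fun i ↦ hW.measurableSet.inter
    (MeasurableSet.disjointed (fun i ↦ (hBo i).measurableSet) i), ?_, ?_, ?_⟩
  · exact fun i j hij ↦ (disjoint_disjointed B hij).mono inter_subset_right inter_subset_right
  · exact fun i ↦ (hBi i).mono (inter_subset_right.trans (disjointed_subset B i))
  · rw [← inter_iUnion, iUnion_disjointed]; exact inter_eq_left.2 hBW

/-- The Dirichlet integral of a holomorphic map into the unit disc is at most `π` if its `n`-th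
power has valency at most `n`. -/
lemma lintegral_enorm_deriv_sq_le_pi {F : ℂ → ℂ} {W : Set ℂ} (hW : IsOpen W)
    (hF : DifferentiableOn ℂ F W) (hF1 : ∀ w ∈ W, ‖F w‖ ≤ 1) {n : ℕ} (hn : n ≠ 0)
    (hval : ∀ y ≠ 0, {w ∈ W | F w ^ n = y}.encard ≤ n) :
    ∫⁻ w in W, ‖deriv F w‖ₑ ^ 2 ≤ ENNReal.ofReal Real.pi := by
  have hder : DifferentiableOn ℂ (deriv F) W := hF.deriv hW
  set W' := {w ∈ W | deriv F w ≠ 0} with hW'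
  have hW'o : IsOpen W' := hder.continuousOn.isOpen_inter_preimage hW isOpen_ne
  have hW'W : W' ⊆ W := fun w hw ↦ hw.1
  obtain ⟨A, hAm, hAd, hAi, hAW⟩ := exists_measurable_partition_injOn hW'o (hF.mono hW'W)
    (fun w hw ↦ hw.2)
  have hAsub : ∀ i, A i ⊆ W' := fun i ↦ hAW ▸ subset_iUnion A i
  have hdiff : ∀ i, ∀ w ∈ A i, DifferentiableAt ℂ F w := fun i w hw ↦
    hF.differentiableAt (hW.mem_nhds (hW'W (hAsub i hw)))
  have himg : ∀ i, MeasurableSet (F '' A i) := fun i ↦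
    measurable_image_of_fderivWithin (hAm i) (fun w hw ↦
      ((hdiff i w hw).hasDerivAt.hasFDerivAt.restrictScalars ℝ).hasFDerivWithinAt) (hAi i)
  have hsum : ∫⁻ w in W, ‖deriv F w‖ₑ ^ 2 = ∑' i, volume (F '' A i) := by
    have : ∫⁻ w in W, ‖deriv F w‖ₑ ^ 2 = ∫⁻ w in W', ‖deriv F w‖ₑ ^ 2 := by
      rw [← lintegral_indicator hW.measurableSet, ← lintegral_indicator hW'o.measurableSet]
      refine lintegral_congr fun w ↦ ?_
      by_cases h : deriv F w = 0 <;> by_cases h2 : w ∈ W <;> simp [indicator, hW', h, h2]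
    rw [this, ← hAW, lintegral_iUnion hAm hAd]
    exact tsum_congr fun i ↦ lintegral_enorm_deriv_sq_eq_volume_image (hAm i) (hdiff i) (hAi i)
  set N : ℂ → ENNReal := fun y ↦ ∑' i, (F '' A i).indicator 1 y with hN
  have hNm : Measurable N := Measurable.tsum fun i ↦ measurable_one.indicator (himg i)
  have hNint : ∫⁻ y, N y = ∑' i, volume (F '' A i) := by
    rw [hN, lintegral_tsum fun i ↦ (measurable_one.indicator (himg i)).aemeasurable]
    exact tsum_congr fun i ↦ lintegral_indicator_one (himg i)
  set ω : ℂ := Complex.exp (2 * Real.pi * Complex.I / n) with hω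
  have hprim : IsPrimitiveRoot ω n := Complex.isPrimitiveRoot_exp n hn
  have hrot : ∀ k : Fin n, ∫⁻ y, N (ω ^ (k : ℕ) * y) = ∫⁻ y, N y := by
    intro k
    have hmem : ω ^ (k : ℕ) ∈ Submonoid.unitSphere ℂ := by
      simp [Submonoid.unitSphere, hprim.norm'_eq_one hn]
    exact (rotation ⟨ω ^ (k : ℕ), hmem⟩).measurePreserving.lintegral_comp hNm
  have hpt : ∀ y ≠ 0, ∑ k : Fin n, N (ω ^ (k : ℕ) * y) ≤
      n * (closedBall (0 : ℂ) 1).indicator 1 y := by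
    intro y hy
    by_cases hy1 : y ∈ closedBall (0 : ℂ) 1
    · rw [indicator_of_mem hy1, Pi.one_apply, mul_one]
      set S : Set (Fin n × ℕ) := {p | ω ^ (p.1 : ℕ) * y ∈ F '' A p.2} with hS
      have h1 : ∑ k : Fin n, N (ω ^ (k : ℕ) * y) = S.encard := by
        rw [← ENNReal.tsum_set_one, tsum_subtype S fun _ ↦ (1 : ENNReal), ENNReal.tsum_prod',
          tsum_fintype]
        rfl
      have h2 : S.encard ≤ {w ∈ W | F w ^ n = y ^ n}.encard := by
        have hch : ∀ p ∈ S, ∃ w, w ∈ A p.2 ∧ F w = ω ^ (p.1 : ℕ) * y := fun p hp ↦ hp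
        choose! g hg using hch
        refine encard_le_encard_of_injOn (f := g) (fun p hp ↦ ⟨hW'W (hAsub _ (hg p hp).1), ?_⟩) ?_
        · rw [(hg p hp).2, mul_pow, ← pow_mul, mul_comm (p.1 : ℕ), pow_mul,
            hprim.pow_eq_one, one_pow, one_mul]
        · rintro ⟨k, i⟩ hp ⟨l, j⟩ hq heq
          have hij : i = j := by
            by_contra hne
            exact (disjoint_left.1 (hAd hne) (hg _ hp).1) (heq ▸ (hg _ hq).1)
          have hkl : ω ^ (k : ℕ) = ω ^ (l : ℕ) := by
            refine mul_right_cancel₀ hy ?_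
            rw [← (hg _ hp).2, ← (hg _ hq).2, heq]
          have := hprim.pow_inj k.2 l.2 hkl
          rw [hij, Fin.ext this]
      rw [h1]
      exact_mod_cast h2.trans (hval _ (pow_ne_zero n hy))
    · refine le_of_eq_of_le ?_ zero_le
      refine Finset.sum_eq_zero fun k _ ↦ ENNReal.tsum_eq_zero.2 fun i ↦ indicator_of_notMem ?_ _
      rintro ⟨w, hw, hwy⟩
      have := hF1 w (hW'W (hAsub i hw))
      rw [hwy, norm_mul, norm_pow, hprim.norm'_eq_one hn, one_pow, one_mul] at this
      exact hy1 (mem_closedBall_zero_iff.2 this)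
  have hmul : n * ∫⁻ w in W, ‖deriv F w‖ₑ ^ 2 ≤ n * ENNReal.ofReal Real.pi := by
    calc n * ∫⁻ w in W, ‖deriv F w‖ₑ ^ 2 = ∑ k : Fin n, ∫⁻ y, N (ω ^ (k : ℕ) * y) := by
          simp [hrot, hsum, hNint]
      _ = ∫⁻ y, ∑ k : Fin n, N (ω ^ (k : ℕ) * y) :=
          (lintegral_finsetSum _ fun k _ ↦ hNm.comp (by fun_prop)).symm
      _ ≤ ∫⁻ y, n * (closedBall (0 : ℂ) 1).indicator 1 y := by
          refine lintegral_mono_ae ?_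
          filter_upwards [Measure.ae_ne volume 0] with y hy using hpt y hy
      _ = n * ENNReal.ofReal Real.pi := by
          rw [lintegral_const_mul' _ _ (ENNReal.natCast_ne_top n),
            lintegral_indicator_one measurableSet_closedBall, Complex.volume_closedBall]
          simp [← NNReal.coe_real_pi, ENNReal.ofReal_coe_nnreal]
  exact (ENNReal.mul_le_mul_iff_right (by exact_mod_cast hn) (ENNReal.natCast_ne_top n)).1 hmul

lemma exists_norm_sub_mul_norm_sub_eq_re_sub (a : ℝ) :
    ∃ s t : ℂ, ∀ ζ : ℂ, ‖ζ‖ = 1 → ‖ζ - s‖ * ‖ζ - t‖ = 2 * |ζ.re - a| := by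
  obtain ⟨r, hr⟩ := IsAlgClosed.exists_pow_nat_eq ((a : ℂ) ^ 2 - 1) two_pos
  refine ⟨a + r, a - r, fun ζ hζ ↦ ?_⟩
  have hconj : ζ * (starRingEnd ℂ) ζ = 1 := by
    rw [Complex.mul_conj, Complex.normSq_eq_norm_sq, hζ]; simp
  have hre : ζ + (starRingEnd ℂ) ζ = ((2 * ζ.re : ℝ) : ℂ) := Complex.add_conj ζ
  have hfac : (ζ - (a + r)) * (ζ - (a - r)) = ζ * ((2 * (ζ.re - a) : ℝ) : ℂ) := by
    push_cast at hre ⊢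
    linear_combination ζ * hre - hconj - hr
  rw [← norm_mul, hfac, norm_mul, hζ, one_mul, Complex.norm_real, Real.norm_eq_abs, abs_mul,
    abs_of_pos (two_pos : (0 : ℝ) < 2)]

lemma exists_mem_Icc_sum_mul_log_abs_sub_ge {ι : Type*} (S : Finset ι) (ν : ι → ℝ)
    (hν : ∀ i ∈ S, 0 ≤ ν i) (a : ι → ℝ) :
    ∃ x ∈ Icc (-1 : ℝ) 1, (∀ i ∈ S, x ≠ a i) ∧
      0 ≤ ∑ i ∈ S, ν i * Real.log (2 * |x - a i|) := by
  choose s t hst using fun i ↦ exists_norm_sub_mul_norm_sub_eq_re_sub (a i)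
  set g : ℂ → ℝ := fun ζ ↦ ∑ i ∈ S, ν i * (Real.log ‖ζ - s i‖ + Real.log ‖ζ - t i‖) with hg
  have hci : ∀ i, CircleIntegrable (fun ζ ↦ Real.log ‖ζ - s i‖ + Real.log ‖ζ - t i‖) 0 1 :=
    fun i ↦ (circleIntegrable_log_norm_sub_const 1).add (circleIntegrable_log_norm_sub_const 1)
  have hci' : ∀ i, CircleIntegrable
      (fun ζ ↦ ν i * (Real.log ‖ζ - s i‖ + Real.log ‖ζ - t i‖)) 0 1 :=
    fun i ↦ IntervalIntegrable.const_mul (hci i) (ν i)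
  have hgi : CircleIntegrable g 0 1 := CircleIntegrable.fun_sum S fun i _ ↦ hci' i
  have hav : 0 ≤ Real.circleAverage g 0 1 := by
    rw [hg, Real.circleAverage_fun_sum fun i _ ↦ hci' i]
    refine Finset.sum_nonneg fun i hi ↦ ?_
    simp_rw [← smul_eq_mul]
    rw [Real.circleAverage_fun_smul, Real.circleAverage_fun_add
      (circleIntegrable_log_norm_sub_const 1) (circleIntegrable_log_norm_sub_const 1),
      circleAverage_log_norm_sub_const_eq_posLog, circleAverage_log_norm_sub_const_eq_posLog]
    exact mul_nonneg (hν i hi) (add_nonneg Real.posLog_nonneg Real.posLog_nonneg)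
  have hcount : (circleMap 0 1 ⁻¹' (⋃ i ∈ S, {ζ : ℂ | ζ ∈ ({s i, t i} : Set ℂ)})).Countable :=
    Set.Countable.preimage_circleMap
      (S.countable_toSet.biUnion fun i _ ↦ ((finite_singleton _).insert _).countable) 0 one_ne_zero
  have hfin : IsFiniteMeasure (volume.restrict (uIoc 0 (2 * Real.pi))) :=
    ⟨by rw [Measure.restrict_apply_univ, uIoc_of_le (by positivity)]; exact measure_Ioc_lt_top⟩
  obtain ⟨θ, hθ, hle⟩ := exists_notMem_null_average_le
    (μ := volume.restrict (uIoc 0 (2 * Real.pi))) (f := fun θ ↦ g (circleMap 0 1 θ))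
    (by
      rw [Ne, Measure.restrict_eq_zero, uIoc_of_le (by positivity)]
      simp [Real.pi_pos])
    (intervalIntegrable_iff.1 hgi)
    (hcount.measure_zero _)
  rw [← Real.circleAverage_eq_intervalAverage] at hle
  set ζ := circleMap 0 1 θ with hζ
  have hζ1 : ‖ζ‖ = 1 := by simp [hζ]
  have hne : ∀ i ∈ S, 0 < ‖ζ - s i‖ ∧ 0 < ‖ζ - t i‖ := by
    intro i hi
    simp only [mem_preimage, mem_iUnion, not_exists] at hθ
    have := hθ i hi
    simp only [mem_insert_iff, mem_singleton_iff, mem_ofPred_eq, not_or] at this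
    exact ⟨norm_pos_iff.2 (sub_ne_zero.2 this.1), norm_pos_iff.2 (sub_ne_zero.2 this.2)⟩
  refine ⟨ζ.re, abs_le.1 (hζ1 ▸ Complex.abs_re_le_norm ζ), fun i hi heq ↦ ?_, ?_⟩
  · have := hst i ζ hζ1
    rw [heq, sub_self, abs_zero, mul_zero] at this
    exact (mul_pos (hne i hi).1 (hne i hi).2).ne' this
  · refine (hav.trans hle).trans_eq (Finset.sum_congr rfl fun i hi ↦ ?_)
    have ⟨hs, ht⟩ := hne i hi
    rw [← hst i ζ hζ1, Real.log_mul (ne_of_gt hs) (ne_of_gt ht)]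

/-- A connected set containing `0` and `ζ₀` has logarithmic capacity at least `‖ζ₀‖ / 4`. -/
lemma IsPreconnected.exists_sum_mul_log_norm_sub_ge {E : Set ℂ} (hE : IsPreconnected E)
    (h0 : 0 ∈ E) {ζ₀ : ℂ} (hζ₀ : ζ₀ ∈ E) (hne : ζ₀ ≠ 0) {ι : Type*} (S : Finset ι) (ν : ι → ℝ)
    (hν : ∀ i ∈ S, 0 ≤ ν i) (a : ι → ℂ) :
    ∃ ζ ∈ E, (∑ i ∈ S, ν i) * Real.log (‖ζ₀‖ / 4) ≤ ∑ i ∈ S, ν i * Real.log ‖a i - ζ‖ := by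
  set L := ‖ζ₀‖ with hL
  have hLpos : 0 < L := norm_pos_iff.2 hne
  set P : ℂ → ℝ := fun ζ ↦ (ζ * (starRingEnd ℂ) ζ₀).re / L with hP
  have hPsub : ∀ u v, |P u - P v| ≤ ‖u - v‖ := by
    intro u v
    rw [hP]
    simp only
    rw [← sub_div, ← Complex.sub_re, ← sub_mul, abs_div, abs_of_pos hLpos, div_le_iff₀ hLpos]
    refine (Complex.abs_re_le_norm _).trans_eq ?_
    rw [norm_mul, RCLike.norm_conj]
  have hP0 : P 0 = 0 := by simp [hP]
  have hP1 : P ζ₀ = L := by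
    simp only [hP, Complex.mul_conj, Complex.ofReal_re, Complex.normSq_eq_norm_sq, ← hL]
    field_simp
  obtain ⟨x, hx, hxne, hsum⟩ := exists_mem_Icc_sum_mul_log_abs_sub_ge S ν hν
    (fun i ↦ 2 * P (a i) / L - 1)
  have hPc : ContinuousOn P E := by simp only [hP]; fun_prop
  obtain ⟨ζ, hζE, hζ⟩ := hE.intermediate_value h0 hζ₀ hPc
    (show L * (x + 1) / 2 ∈ Icc (P 0) (P ζ₀) by
      rw [hP0, hP1]
      constructor <;> nlinarith [hx.1, hx.2])
  refine ⟨ζ, hζE, ?_⟩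
  rw [Finset.sum_mul, ← sub_nonneg, ← Finset.sum_sub_distrib]
  refine hsum.trans (Finset.sum_le_sum fun i hi ↦ ?_)
  rw [← mul_sub]
  refine mul_le_mul_of_nonneg_left ?_ (hν i hi)
  have hpos : 0 < |x - (2 * P (a i) / L - 1)| := abs_pos.2 (sub_ne_zero.2 (hxne i hi))
  rw [le_sub_iff_add_le, ← Real.log_mul (by positivity) (by positivity)]
  refine Real.log_le_log (by positivity) ?_
  refine le_trans (le_of_eq ?_) (hPsub (a i) ζ)
  rw [abs_sub_comm (P (a i)), hζ,
    show L * (x + 1) / 2 - P (a i) = L / 2 * (x - (2 * P (a i) / L - 1)) by field_simp; ring,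
    abs_mul, abs_of_pos (by positivity : 0 < L / 2)]
  ring

/-- One-sided minimax: if every mixture of the functions `Φ s` has a value at least `c₀`
somewhere on `E`, then a suitable empirical average over points of `E` is almost `c₀` for all `s`
at once. The proof runs the exponential-weights strategy. -/
lemma exists_forall_mul_le_sum_of_forall_mixture {α β : Type*} {E : Set β} (S : Finset α)
    (Φ : α → β → ℝ) {B c c₀ : ℝ} (hB : ∀ s ∈ S, ∀ ζ ∈ E, |Φ s ζ| ≤ B) (hc : c < c₀)
    (hmix : ∀ ν : α → ℝ, (∀ s ∈ S, 0 ≤ ν s) → ∃ ζ ∈ E, (∑ s ∈ S, ν s) * c₀ ≤ ∑ s ∈ S, ν s * Φ s ζ) :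
    ∃ n : ℕ, n ≠ 0 ∧ ∃ ζ : ℕ → β, (∀ i, ζ i ∈ E) ∧
      ∀ s ∈ S, n * c ≤ ∑ i ∈ Finset.range n, Φ s (ζ i) := by
  obtain ⟨ζ₁, hζ₁, -⟩ := hmix 0 (by simp)
  set M := max B 1 with hM
  have hM1 : 1 ≤ M := le_max_right _ _
  have hMB : ∀ s ∈ S, ∀ ζ ∈ E, |Φ s ζ| ≤ M := fun s hs ζ hζ ↦ (hB s hs ζ hζ).trans (le_max_left _ _)
  obtain ⟨η, hη0, hη1, hη2⟩ : ∃ η : ℝ, 0 < η ∧ η * M ≤ 1 ∧ η * M ^ 2 < c₀ - c := by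
    refine ⟨min (1 / M) ((c₀ - c) / (2 * M ^ 2)), ?_, ?_, ?_⟩
    · have : 0 < c₀ - c := by linarith
      positivity
    · calc _ ≤ 1 / M * M := by gcongr; exact min_le_left _ _
        _ = 1 := by field_simp
    · calc _ ≤ (c₀ - c) / (2 * M ^ 2) * M ^ 2 := by gcongr; exact min_le_right _ _
        _ = (c₀ - c) / 2 := by field_simp
        _ < c₀ - c := by linarith
  have hexp : ∀ s ∈ S, ∀ ζ ∈ E, Real.exp (-η * Φ s ζ) ≤ 1 - η * Φ s ζ + η ^ 2 * M ^ 2 := by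
    intro s hs ζ hζ
    have h1 := hMB s hs ζ hζ
    have h2 : |-η * Φ s ζ| ≤ 1 := by
      rw [abs_mul, abs_neg, abs_of_pos hη0]
      exact (mul_le_mul_of_nonneg_left h1 hη0.le).trans hη1
    have h3 := (abs_le.1 (Real.abs_exp_sub_one_sub_id_le h2)).2
    have h4 : Φ s ζ ^ 2 ≤ M ^ 2 := sq_le_sq' (abs_le.1 h1).1 (abs_le.1 h1).2
    nlinarith [mul_le_mul_of_nonneg_left h4 (sq_nonneg η)]
  have hpot : ∀ n : ℕ, ∃ ζ : ℕ → β, (∀ i, ζ i ∈ E) ∧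
      ∑ s ∈ S, Real.exp (-η * ∑ i ∈ Finset.range n, Φ s (ζ i)) ≤
        S.card * Real.exp (n * (-η * c₀ + η ^ 2 * M ^ 2)) := by
    intro n
    induction n with
    | zero => exact ⟨fun _ ↦ ζ₁, fun _ ↦ hζ₁, by simp⟩
    | succ n ih =>
      obtain ⟨ζ, hζE, hζ⟩ := ih
      set ν : α → ℝ := fun s ↦ Real.exp (-η * ∑ i ∈ Finset.range n, Φ s (ζ i)) with hν
      obtain ⟨ξ, hξE, hξ⟩ := hmix ν fun s _ ↦ (Real.exp_pos _).le
      refine ⟨Function.update ζ n ξ, fun i ↦ ?_, ?_⟩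
      · by_cases h : i = n
        · subst h; simpa using hξE
        · simpa [h] using hζE i
      calc ∑ s ∈ S, Real.exp (-η * ∑ i ∈ Finset.range (n + 1), Φ s (Function.update ζ n ξ i))
          = ∑ s ∈ S, ν s * Real.exp (-η * Φ s ξ) := by
            refine Finset.sum_congr rfl fun s _ ↦ ?_
            have hupd : ∑ i ∈ Finset.range n, Φ s (Function.update ζ n ξ i) =
                ∑ i ∈ Finset.range n, Φ s (ζ i) := Finset.sum_congr rfl fun i hi ↦ by
              rw [Function.update_of_ne (Finset.mem_range.1 hi).ne]
            rw [Finset.sum_range_succ, Function.update_self, mul_add, Real.exp_add, hupd]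
        _ ≤ ∑ s ∈ S, ν s * (1 - η * Φ s ξ + η ^ 2 * M ^ 2) := by
            refine Finset.sum_le_sum fun s hs ↦ ?_
            exact mul_le_mul_of_nonneg_left (hexp s hs ξ hξE) (Real.exp_pos _).le
        _ = (∑ s ∈ S, ν s) * (1 + η ^ 2 * M ^ 2) - η * ∑ s ∈ S, ν s * Φ s ξ := by
            rw [Finset.sum_mul, Finset.mul_sum, ← Finset.sum_sub_distrib]
            exact Finset.sum_congr rfl fun s _ ↦ by ring
        _ ≤ (∑ s ∈ S, ν s) * (1 + (-η * c₀ + η ^ 2 * M ^ 2)) := by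
            nlinarith [mul_le_mul_of_nonneg_left hξ hη0.le]
        _ ≤ (∑ s ∈ S, ν s) * Real.exp (-η * c₀ + η ^ 2 * M ^ 2) := by
            refine mul_le_mul_of_nonneg_left ?_ (Finset.sum_nonneg fun s _ ↦ (Real.exp_pos _).le)
            linarith [Real.add_one_le_exp (-η * c₀ + η ^ 2 * M ^ 2)]
        _ ≤ S.card * Real.exp (n * (-η * c₀ + η ^ 2 * M ^ 2)) *
              Real.exp (-η * c₀ + η ^ 2 * M ^ 2) := by gcongr
        _ = S.card * Real.exp ((n + 1 : ℕ) * (-η * c₀ + η ^ 2 * M ^ 2)) := by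
            rw [mul_assoc, ← Real.exp_add]; push_cast; ring_nf
  have hgap : 0 < η * (c₀ - c - η * M ^ 2) := mul_pos hη0 (by linarith)
  obtain ⟨n, hn⟩ := exists_nat_ge (Real.log S.card / (η * (c₀ - c - η * M ^ 2)))
  rw [div_le_iff₀ hgap] at hn
  obtain ⟨ζ, hζE, hζ⟩ := hpot (n + 1)
  refine ⟨n + 1, by simp, ζ, hζE, fun s hs ↦ ?_⟩
  have hcard : (0 : ℝ) < S.card := by exact_mod_cast Finset.card_pos.2 ⟨s, hs⟩
  have h1 := (Finset.single_le_sum (f := fun s ↦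
    Real.exp (-η * ∑ i ∈ Finset.range (n + 1), Φ s (ζ i))) (fun s _ ↦ (Real.exp_pos _).le) hs).trans hζ
  rw [← Real.log_le_log_iff (Real.exp_pos _) (by positivity), Real.log_exp,
    Real.log_mul hcard.ne' (Real.exp_pos _).ne', Real.log_exp] at h1
  push_cast at h1 ⊢
  have h2 : η * ((n + 1) * c) ≤ η * ∑ i ∈ Finset.range (n + 1), Φ s (ζ i) := by nlinarith
  exact le_of_mul_le_mul_left h2 hη0

/-- A compact connected set `E` containing `0` and `ζ₀` carries the zeros of monic polynomials
that are at least `r ^ n` in modulus on a given compact set disjoint from `E`, for every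
`r < ‖ζ₀‖ / 4`. -/
lemma IsCompact.exists_pow_le_prod_norm_sub {E K : Set ℂ} (hE : IsCompact E)
    (hEc : IsPreconnected E) (h0 : 0 ∈ E) {ζ₀ : ℂ} (hζ₀ : ζ₀ ∈ E) (hne : ζ₀ ≠ 0)
    (hK : IsCompact K) (hKE : Disjoint K E) {r : ℝ} (hr0 : 0 < r) (hr : r < ‖ζ₀‖ / 4) :
    ∃ n : ℕ, n ≠ 0 ∧ ∃ ζ : ℕ → ℂ, (∀ i, ζ i ∈ E) ∧
      ∀ s ∈ K, r ^ n ≤ ∏ i ∈ Finset.range n, ‖s - ζ i‖ := by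
  obtain ⟨r', hrr', hr'⟩ := exists_between hr
  have hr'0 : 0 < r' := hr0.trans hrr'
  obtain ⟨ρ, hρ0, hρ⟩ := Metric.exists_pos_forall_lt_edist hK hE.isClosed hKE
  have hρ' : ∀ s ∈ K, ∀ ζ ∈ E, (ρ : ℝ) ≤ ‖s - ζ‖ := by
    intro s hs ζ hζ
    have := hρ s hs ζ hζ
    rw [edist_nndist, ENNReal.coe_lt_coe] at this
    rw [← dist_eq_norm, ← coe_nndist]
    exact_mod_cast this.le
  obtain ⟨M₁, hM₁⟩ := hK.isBounded.exists_norm_le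
  obtain ⟨M₂, hM₂⟩ := hE.isBounded.exists_norm_le
  have hρpos : (0 : ℝ) < ρ := by exact_mod_cast hρ0
  have hη : 0 < (ρ : ℝ) * (r' / r - 1) :=
    mul_pos hρpos (sub_pos.2 ((one_lt_div hr0).2 hrr'))
  obtain ⟨t, htK, htfin, htcov⟩ := hK.finite_cover_balls hη
  lift t to Finset ℂ using htfin
  obtain ⟨n, hn, ζ, hζE, hζ⟩ := exists_forall_mul_le_sum_of_forall_mixture t
    (fun s ζ ↦ Real.log ‖s - ζ‖) (B := max |Real.log ρ| |Real.log (M₁ + M₂)|)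
    (fun s hs ζ hζ ↦ abs_le_max_abs_abs (Real.log_le_log hρpos (hρ' s (htK hs) ζ hζ))
      (Real.log_le_log (hρpos.trans_le (hρ' s (htK hs) ζ hζ))
        ((norm_sub_le _ _).trans (add_le_add (hM₁ s (htK hs)) (hM₂ ζ hζ)))))
    (Real.log_lt_log hr'0 hr')
    (fun ν hν ↦ hEc.exists_sum_mul_log_norm_sub_ge h0 hζ₀ hne t ν hν id)
  refine ⟨n, hn, ζ, hζE, fun s hs ↦ ?_⟩
  obtain ⟨s', hs't, hs'⟩ := mem_iUnion₂.1 (htcov hs)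
  have hs'K := htK hs't
  have hnet : r' ^ n ≤ ∏ i ∈ Finset.range n, ‖s' - ζ i‖ := by
    have h1 := hζ s' hs't
    have hpos : ∀ i ∈ Finset.range n, ‖s' - ζ i‖ ≠ 0 := fun i _ ↦
      (hρpos.trans_le (hρ' s' hs'K _ (hζE i))).ne'
    rwa [← Real.log_prod hpos, ← Real.log_pow, Real.log_le_log_iff (by positivity)
      (Finset.prod_pos fun i _ ↦ hρpos.trans_le (hρ' s' hs'K _ (hζE i)))] at h1
  have hcmp : ∏ i ∈ Finset.range n, ‖s' - ζ i‖ ≤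
      (r' / r) ^ n * ∏ i ∈ Finset.range n, ‖s - ζ i‖ := by
    calc _ ≤ ∏ i ∈ Finset.range n, r' / r * ‖s - ζ i‖ := by
          refine Finset.prod_le_prod (fun i _ ↦ norm_nonneg _) fun i _ ↦ ?_
          have h1 := hρ' s hs _ (hζE i)
          have h2 : ‖s' - ζ i‖ ≤ ‖s - ζ i‖ + ‖s - s'‖ := by
            rw [show s' - ζ i = (s - ζ i) - (s - s') by ring]
            exact norm_sub_le _ _
          rw [mem_ball, dist_eq_norm] at hs'
          have h3 : 0 ≤ r' / r - 1 := (sub_pos.2 ((one_lt_div hr0).2 hrr')).le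
          nlinarith [mul_le_mul_of_nonneg_right h1 h3]
      _ = _ := by rw [Finset.prod_mul_distrib, Finset.prod_const, Finset.card_range]
  have h1 := hnet.trans hcmp
  rw [div_pow, div_mul_eq_mul_div, le_div_iff₀ (by positivity)] at h1
  exact le_of_mul_le_mul_left h1 (by positivity)

/-- A holomorphic logarithm of `1 - ζ w` exists on `W` for every `ζ` in a connected set through
`0` on which `1 - ζ w` stays away from `0`. -/
lemma exists_differentiableOn_exp_eq_one_sub_mul {E W : Set ℂ} (hE : IsPreconnected E)
    (h0 : 0 ∈ E) (hW : Bornology.IsBounded W) {δ : ℝ} (hδ : 0 < δ)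
    (hEW : ∀ ζ ∈ E, ∀ w ∈ W, δ ≤ ‖1 - ζ * w‖) {ζ : ℂ} (hζ : ζ ∈ E) :
    ∃ l : ℂ → ℂ, DifferentiableOn ℂ l W ∧ ∀ w ∈ W, Complex.exp (l w) = 1 - ζ * w := by
  obtain ⟨M, hM0, hM⟩ := hW.exists_pos_norm_le
  set G : Set ℂ := {ζ | ∃ l : ℂ → ℂ, DifferentiableOn ℂ l W ∧
    ∀ w ∈ W, Complex.exp (l w) = 1 - ζ * w} with hG
  have hstep : ∀ ζ ∈ E, ∀ ζ' ∈ E, ‖ζ' - ζ‖ < δ / M → ζ ∈ G → ζ' ∈ G := by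
    rintro ζ hζ ζ' hζ' hdist ⟨l, hl, hexp⟩
    have hne : ∀ w ∈ W, 1 - ζ * w ≠ 0 := fun w hw ↦ norm_pos_iff.1 (hδ.trans_le (hEW ζ hζ w hw))
    have hslit : ∀ w ∈ W, (1 - ζ' * w) / (1 - ζ * w) ∈ Complex.slitPlane := by
      intro w hw
      apply Complex.ball_one_subset_slitPlane
      rw [mem_ball, dist_eq_norm, div_sub_one (hne w hw), norm_div,
        div_lt_one (hδ.trans_le (hEW ζ hζ w hw)),
        show 1 - ζ' * w - (1 - ζ * w) = -((ζ' - ζ) * w) by ring, norm_neg, norm_mul]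
      refine lt_of_lt_of_le ?_ (hEW ζ hζ w hw)
      rw [lt_div_iff₀ hM0] at hdist
      exact (mul_le_mul_of_nonneg_left (hM w hw) (norm_nonneg _)).trans_lt hdist
    refine ⟨fun w ↦ l w + Complex.log ((1 - ζ' * w) / (1 - ζ * w)), ?_, fun w hw ↦ ?_⟩
    · refine hl.add (DifferentiableOn.clog (DifferentiableOn.div ?_ ?_ hne) hslit) <;> fun_prop
    · rw [Complex.exp_add, hexp w hw, Complex.exp_log (Complex.slitPlane_ne_zero (hslit w hw)),
        mul_div_cancel₀ _ (hne w hw)]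
  have hδM : 0 < δ / M := by positivity
  have h0G : (0 : ℂ) ∈ G := ⟨0, differentiableOn_const _, by simp⟩
  have : ∀ ζ ∈ E, (0 ∈ G ↔ ζ ∈ G) := by
    intro ζ hζ
    refine hE.induction₂ (fun x y ↦ x ∈ G ↔ y ∈ G) ?_ ?_ ?_ h0 hζ
    · intro x hx
      filter_upwards [inter_mem_nhdsWithin E (ball_mem_nhds x hδM)] with y hy
      have hyx : ‖y - x‖ < δ / M := by simpa [dist_eq_norm] using hy.2
      exact ⟨hstep x hx y hy.1 hyx, hstep y hy.1 x hx (by rwa [norm_sub_rev])⟩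
    · exact fun x y z _ _ _ h1 h2 ↦ h1.trans h2
    · exact fun x y _ _ h ↦ h.symm
  exact (this ζ hζ).1 h0G

/-- A rational function `c * w ^ n / ∏ (1 - ζ i * w)` has valency at most `n` away from `0`. -/
lemma encard_setOf_mul_pow_eq_mul_prod_le (n : ℕ) (ζ : ℕ → ℂ) (c : ℂ) {y : ℂ} (hy : y ≠ 0)
    (hn : n ≠ 0) :
    {w : ℂ | c * w ^ n = y * ∏ i ∈ Finset.range n, (1 - ζ i * w)}.encard ≤ n := by
  set P : ℂ[X] := C c * X ^ n - C y * ∏ i ∈ Finset.range n, (1 - C (ζ i) * X) with hP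
  have hP0 : P ≠ 0 := by
    intro h
    have : P.eval 0 = 0 := by rw [h, eval_zero]
    simp [hP, eval_prod, hn, hy] at this
  have hdeg : P.natDegree ≤ n := by
    refine (natDegree_sub_le _ _).trans (max_le (natDegree_C_mul_X_pow_le _ _) ?_)
    refine (natDegree_C_mul_le _ _).trans ((natDegree_prod_le _ _).trans ?_)
    refine (Finset.sum_le_card_nsmul _ _ 1 fun i _ ↦ ?_).trans (by simp)
    refine (natDegree_sub_le _ _).trans (max_le (by simp) ((natDegree_C_mul_le _ _).trans natDegree_X_le))
  have hsub : {w : ℂ | c * w ^ n = y * ∏ i ∈ Finset.range n, (1 - ζ i * w)} ⊆ P.roots.toFinset := by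
    intro w hw
    rw [mem_ofPred_eq] at hw
    rw [Finset.mem_coe, Multiset.mem_toFinset, mem_roots hP0, IsRoot.def]
    simp [hP, eval_prod, hw]
  refine (encard_le_encard hsub).trans ?_
  rw [encard_coe_eq_coe_finsetCard]
  exact_mod_cast (Multiset.toFinset_card_le _).trans ((card_roots' P).trans hdeg)

/-- On compact parts of `D`, there are holomorphic maps to the unit disc with Dirichlet integral
at most `π` and derivative at `0` as close to `1 / (4 d)` as desired. -/
lemma exists_differentiableOn_norm_deriv_eq {D : Set ℂ} (hD : IsOpen D)
    (hb : Bornology.IsBounded D) (hc : IsConnected Dᶜ) {d : ℝ} (hd : 0 < d)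
    (hball : ball (0 : ℂ) d ⊆ D) {a : ℂ} (ha : a ∉ D) (had : ‖a‖ = d) {K : Set ℂ}
    (hK : IsCompact K) (hKD : K ⊆ D) {R : ℝ} (hR0 : 0 < R) (hR : R < 1 / (4 * d)) :
    ∃ (W : Set ℂ) (F : ℂ → ℂ), IsOpen W ∧ K ⊆ W ∧ W ⊆ D ∧ DifferentiableOn ℂ F W ∧
      (∀ w ∈ W, ‖F w‖ ≤ 1) ∧ ‖deriv F 0‖ = R ∧
      ∫⁻ w in W, ‖deriv F w‖ₑ ^ 2 ≤ ENNReal.ofReal Real.pi := by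
  have h0D : (0 : ℂ) ∈ D := hball (mem_ball_self hd)
  set E := reciprocalCompl D with hE
  have hEcpt : IsCompact E := isCompact_reciprocalCompl hD h0D
  have hEcon : IsPreconnected E := (isConnected_reciprocalCompl hb hc h0D).isPreconnected
  have h0E : 0 ∈ E := zero_mem_reciprocalCompl D
  have ha0 : a ≠ 0 := norm_pos_iff.1 (had ▸ hd)
  obtain ⟨L, hL, hKL, hLD⟩ := exists_compact_between (hK.insert 0) hD
    (insert_subset h0D hKD)
  have h0L : (0 : ℂ) ∈ interior L := hKL (mem_insert _ _)
  obtain ⟨δ, hδ, hEL⟩ : ∃ δ > 0, ∀ ζ ∈ E, ∀ w ∈ L, δ ≤ ‖1 - ζ * w‖ := by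
    obtain ⟨p, hp, hmin⟩ := (hEcpt.prod hL).exists_isMinOn (f := fun p : ℂ × ℂ ↦ ‖1 - p.1 * p.2‖)
      ⟨(0, 0), h0E, interior_subset h0L⟩ (by fun_prop)
    exact ⟨_, norm_pos_iff.2 (hp.1 _ (hLD hp.2)), fun ζ hζ w hw ↦ hmin (mk_mem_prod hζ hw)⟩
  have hK' : IsCompact ((·⁻¹) '' (L ∩ {w : ℂ | d / 2 ≤ ‖w‖})) := by
    refine (hL.inter_right (isClosed_le continuous_const continuous_norm)).image_of_continuousOn ?_
    refine continuousOn_inv₀.mono fun w hw ↦ norm_pos_iff.1 ?_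
    exact (half_pos hd).trans_le hw.2
  have hdisj : Disjoint ((·⁻¹) '' (L ∩ {w : ℂ | d / 2 ≤ ‖w‖})) E := by
    rw [Set.disjoint_left]
    rintro _ ⟨w, hw, rfl⟩ hwE
    have hw0 : w ≠ 0 := norm_pos_iff.1 ((half_pos hd).trans_le hw.2)
    exact hwE w (hLD hw.1) (by simp [hw0])
  obtain ⟨n, hn, ζ, hζE, hζ⟩ := hEcpt.exists_pow_le_prod_norm_sub hEcon h0E
    (inv_mem_reciprocalCompl ha0 ha) (inv_ne_zero ha0) hK' hdisj hR0
    (by rw [norm_inv, had]; exact hR.trans_eq (by field_simp))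
  have hW : interior L ⊆ L := interior_subset
  choose l hl hexp using fun i ↦ exists_differentiableOn_exp_eq_one_sub_mul hEcon h0E
    (hL.isBounded.subset hW) hδ (fun ζ hζ w hw ↦ hEL ζ hζ w (hW hw)) (hζE i)
  set q : ℂ → ℂ := fun w ↦ Complex.exp (-(∑ i ∈ Finset.range n, l i w) / n) with hq
  have hqd : DifferentiableOn ℂ q (interior L) :=
    ((DifferentiableOn.fun_sum fun i _ ↦ hl i).neg.div_const _).cexp
  have hn' : (n : ℂ) ≠ 0 := Nat.cast_ne_zero.2 hn
  have hqn : ∀ w ∈ interior L, q w ^ n * ∏ i ∈ Finset.range n, (1 - ζ i * w) = 1 := by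
    intro w hw
    rw [hq, ← Complex.exp_nat_mul, mul_div_cancel₀ _ hn',
      Finset.prod_congr rfl fun i _ ↦ (hexp i w hw).symm, ← Complex.exp_sum, ← Complex.exp_add]
    simp
  set F : ℂ → ℂ := fun w ↦ R * w * q w with hF
  have hFn : ∀ w ∈ interior L,
      F w ^ n * ∏ i ∈ Finset.range n, (1 - ζ i * w) = (R : ℂ) ^ n * w ^ n := by
    intro w hw
    rw [hF, mul_pow, mul_assoc, hqn w hw, mul_one, mul_pow]
  have hFd : DifferentiableOn ℂ F (interior L) := by
    refine DifferentiableOn.mul ?_ hqd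
    fun_prop
  have hprod : ∀ w ∈ interior L,
      (R * ‖w‖) ^ n ≤ ∏ i ∈ Finset.range n, ‖1 - ζ i * w‖ := by
    intro w hw
    rcases lt_or_ge ‖w‖ (d / 2) with h | h
    · rw [← Finset.card_range n, ← Finset.prod_const, Finset.card_range]
      refine Finset.prod_le_prod (fun i _ ↦ by positivity) fun i _ ↦ ?_
      have h1 : ‖ζ i * w‖ ≤ 1 / 2 := by
        have := norm_mul_le_one_of_mem_reciprocalCompl hball (hζE i)
        rw [norm_mul]
        nlinarith [norm_nonneg (ζ i)]
      have h2 : R * ‖w‖ ≤ 1 / 2 := by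
        rw [lt_div_iff₀ (by positivity)] at hR
        nlinarith
      have h3 := norm_sub_norm_le 1 (ζ i * w)
      rw [norm_one] at h3
      linarith
    · have hw0 : w ≠ 0 := norm_pos_iff.1 ((half_pos hd).trans_le h)
      have h1 := hζ w⁻¹ ⟨w, ⟨hW hw, h⟩, rfl⟩
      calc (R * ‖w‖) ^ n ≤ (∏ i ∈ Finset.range n, ‖w⁻¹ - ζ i‖) * ‖w‖ ^ n := by
            rw [mul_pow]; gcongr
        _ = ∏ i ∈ Finset.range n, ‖w⁻¹ - ζ i‖ * ‖w‖ := by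
            rw [Finset.prod_mul_distrib, Finset.prod_const, Finset.card_range]
        _ = ∏ i ∈ Finset.range n, ‖1 - ζ i * w‖ := by
            refine Finset.prod_congr rfl fun i _ ↦ ?_
            rw [← norm_mul, sub_mul, inv_mul_cancel₀ hw0]
  have hFle : ∀ w ∈ interior L, ‖F w‖ ≤ 1 := by
    intro w hw
    have h1 := congrArg norm (hFn w hw)
    rw [norm_mul, norm_prod, norm_mul, norm_pow, norm_pow, norm_pow, Complex.norm_real,
      Real.norm_of_nonneg hR0.le, ← mul_pow] at h1
    have hpos : 0 < ∏ i ∈ Finset.range n, ‖1 - ζ i * w‖ :=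
      Finset.prod_pos fun i _ ↦ hδ.trans_le (hEL _ (hζE i) w (hW hw))
    have h2 : ‖F w‖ ^ n * ∏ i ∈ Finset.range n, ‖1 - ζ i * w‖ ≤
        1 * ∏ i ∈ Finset.range n, ‖1 - ζ i * w‖ := by
      rw [h1, one_mul]; exact hprod w hw
    exact (pow_le_one_iff_of_nonneg (norm_nonneg _) hn).1 (le_of_mul_le_mul_right h2 hpos)
  refine ⟨interior L, F, isOpen_interior, (subset_insert _ _).trans hKL, hW.trans hLD, hFd, hFle,
    ?_, lintegral_enorm_deriv_sq_le_pi isOpen_interior hFd hFle hn fun y hy ↦ ?_⟩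
  · have hq0 : ‖q 0‖ = 1 := by
      have h1 := congrArg norm (hqn 0 h0L)
      simp only [mul_zero, sub_zero, Finset.prod_const_one, mul_one, norm_pow, norm_one] at h1
      exact (pow_eq_one_iff_of_nonneg (norm_nonneg _) hn).1 h1
    have hder : HasDerivAt F (R * 1 * q 0 + R * 0 * deriv q 0) 0 :=
      ((hasDerivAt_id (0 : ℂ)).const_mul (R : ℂ)).mul
        (hqd.differentiableAt (isOpen_interior.mem_nhds h0L)).hasDerivAt
    rw [hder.deriv]
    simp [hq0, abs_of_pos hR0]
  · refine (encard_le_encard ?_).trans (encard_setOf_mul_pow_eq_mul_prod_le n ζ ((R : ℂ) ^ n) hy hn)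
    rintro w ⟨hw, rfl⟩
    exact (hFn w hw).symm

lemma IsOpen.exists_compact_exhaustion {D : Set ℂ} (hD : IsOpen D) :
    ∃ K : ℕ → Set ℂ, (∀ k, IsCompact (K k)) ∧ (∀ k, K k ⊆ D) ∧
      ∀ C, IsCompact C → C ⊆ D → ∀ᶠ k in atTop, C ⊆ K k := by
  have : LocallyCompactSpace D := hD.locallyCompactSpace
  set e : CompactExhaustion D := CompactExhaustion.choice D
  refine ⟨fun k ↦ Subtype.val '' e k, fun k ↦ (e.isCompact k).image continuous_subtype_val,
    fun k ↦ Subtype.coe_image_subset _ _, fun C hC hCD ↦ ?_⟩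
  obtain ⟨n, hn⟩ := e.exists_superset_of_isCompact (s := Subtype.val ⁻¹' C)
    (Topology.IsInducing.subtypeVal.isCompact_preimage' hC (by simpa using hCD))
  filter_upwards [eventually_ge_atTop n] with k hk w hw
  exact ⟨⟨w, hCD hw⟩, e.subset hk (hn hw), rfl⟩

lemma norm_sub_le_of_norm_le_one {f : ℂ → ℂ} {x : ℂ} {ρ : ℝ} (hρ : 0 < ρ)
    (hf : DifferentiableOn ℂ f (ball x (2 * ρ))) (hf1 : ∀ w ∈ ball x (2 * ρ), ‖f w‖ ≤ 1)
    {y : ℂ} (hy : y ∈ ball x (ρ / 2)) : ‖f y - f x‖ ≤ 1 / ρ * ‖y - x‖ := by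
  refine (convex_ball x (ρ / 2)).norm_image_sub_le_of_norm_deriv_le (f := f) (fun w hw ↦ ?_)
    (fun w hw ↦ ?_) (mem_ball_self (by positivity)) hy
  · exact hf.differentiableAt (isOpen_ball.mem_nhds (ball_subset_ball (by linarith) hw))
  · have hsub : closedBall w ρ ⊆ ball x (2 * ρ) :=
      closedBall_subset_ball' (by rw [mem_ball] at hw; linarith)
    exact Complex.norm_deriv_le_of_forall_mem_sphere_norm_le hρ
      (hf.diffContOnCl_ball hsub)
      fun z hz ↦ hf1 z (hsub (sphere_subset_closedBall hz))

/-- Montel compactness for holomorphic maps into the unit disc with varying domains. -/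
lemma exists_tendstoLocallyUniformlyOn_deriv {D : Set ℂ} (hD : IsOpen D) {ι : Type*}
    (U : Ultrafilter ι) {W : ι → Set ℂ} {F : ι → ℂ → ℂ}
    (hWD : ∀ C, IsCompact C → C ⊆ D → ∀ᶠ m in U, C ⊆ W m)
    (hF : ∀ m, DifferentiableOn ℂ (F m) (W m)) (hF1 : ∀ m, ∀ w ∈ W m, ‖F m w‖ ≤ 1) :
    ∃ f : ℂ → ℂ, DifferentiableOn ℂ f D ∧
      TendstoLocallyUniformlyOn (fun m ↦ deriv (F m)) (deriv f) U D := by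
  have hlim : ∀ w, ∃ y, w ∈ D → Tendsto (fun m ↦ F m w) U (𝓝 y) := by
    intro w
    by_cases hw : w ∈ D
    · obtain ⟨y, -, hy⟩ := (isCompact_closedBall (0 : ℂ) 1).ultrafilter_le_nhds'
        (U.map fun m ↦ F m w) (by
          change ∀ᶠ m in (U : Filter ι), F m w ∈ closedBall (0 : ℂ) 1
          filter_upwards [hWD {w} isCompact_singleton (by simpa using hw)] with m hm
          simpa using hF1 m w (hm rfl))
      exact ⟨y, fun _ ↦ hy⟩
    · exact ⟨0, fun h ↦ absurd h hw⟩
  choose f hf using hlim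
  have hballs : ∀ x ∈ D, ∃ ρ > 0, ball x (2 * ρ) ⊆ D ∧ ∀ᶠ m in U, ball x (2 * ρ) ⊆ W m := by
    intro x hx
    obtain ⟨ε, hε, hεD⟩ := Metric.nhds_basis_closedBall.mem_iff.1 (hD.mem_nhds hx)
    refine ⟨ε / 2, half_pos hε, ?_, ?_⟩
    · rw [mul_div_cancel₀ _ two_ne_zero]; exact ball_subset_closedBall.trans hεD
    · rw [mul_div_cancel₀ _ two_ne_zero]
      filter_upwards [hWD _ (isCompact_closedBall x ε) hεD] with m hm
      exact ball_subset_closedBall.trans hm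
  have hTLU : TendstoLocallyUniformlyOn F f U D := by
    rw [Metric.tendstoLocallyUniformlyOn_iff]
    intro ε hε x hx
    obtain ⟨ρ, hρ, hρD, hρW⟩ := hballs x hx
    have hLip : ∀ᶠ m in U, ∀ y ∈ ball x (ρ / 2), ‖F m y - F m x‖ ≤ 1 / ρ * ‖y - x‖ := by
      filter_upwards [hρW] with m hm y hy
      exact norm_sub_le_of_norm_le_one hρ ((hF m).mono hm) (fun w hw ↦ hF1 m w (hm hw)) hy
    have hLip' : ∀ y ∈ ball x (ρ / 2), ‖f y - f x‖ ≤ 1 / ρ * ‖y - x‖ := by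
      intro y hy
      have hyD : y ∈ D := hρD (ball_subset_ball (by linarith) hy)
      exact le_of_tendsto ((hf y hyD).sub (hf x hx)).norm (hLip.mono fun m hm ↦ hm y hy)
    refine ⟨ball x (min (ρ / 2) (ρ * (ε / 3))),
      mem_nhdsWithin_of_mem_nhds (ball_mem_nhds x (by positivity)), ?_⟩
    filter_upwards [hLip, (Metric.tendsto_nhds.1 (hf x hx)) (ε / 3) (by positivity)]
      with m hm hmx y hy
    have hy1 : y ∈ ball x (ρ / 2) := ball_subset_ball (min_le_left _ _) hy
    have hy2 : 1 / ρ * ‖y - x‖ < ε / 3 := by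
      have : y ∈ ball x (ρ * (ε / 3)) := ball_subset_ball (min_le_right _ _) hy
      rw [mem_ball, dist_eq_norm] at this
      rwa [one_div, inv_mul_lt_iff₀ hρ]
    have h1 := hm y hy1
    have h2 := hLip' y hy1
    rw [dist_eq_norm] at hmx ⊢
    calc ‖f y - F m y‖ = ‖(f y - f x) - (F m y - F m x) - (F m x - f x)‖ := by ring_nf
      _ ≤ ‖f y - f x‖ + ‖F m y - F m x‖ + ‖F m x - f x‖ :=
          (norm_sub_le _ _).trans (add_le_add_left (norm_sub_le _ _) _)
      _ < ε := by linarith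
  have hloc : ∀ x ∈ D, ∃ ρ > 0, ball x ρ ⊆ D ∧ DifferentiableOn ℂ f (ball x ρ) ∧
      TendstoLocallyUniformlyOn (fun m ↦ deriv (F m)) (deriv f) U (ball x ρ) := by
    intro x hx
    obtain ⟨ρ, hρ, hρD, hρW⟩ := hballs x hx
    have hd : ∀ᶠ m in U, DifferentiableOn ℂ (F m) (ball x (2 * ρ)) :=
      hρW.mono fun m hm ↦ (hF m).mono hm
    exact ⟨2 * ρ, by positivity, hρD, (hTLU.mono hρD).differentiableOn hd isOpen_ball,
      (hTLU.mono hρD).deriv hd isOpen_ball⟩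
  refine ⟨f, fun x hx ↦ ?_, ?_⟩
  · obtain ⟨ρ, hρ, -, hd, -⟩ := hloc x hx
    exact (hd.differentiableAt (ball_mem_nhds x hρ)).differentiableWithinAt
  · intro u hu x hx
    obtain ⟨ρ, hρ, hρD, -, hT⟩ := hloc x hx
    obtain ⟨t, ht, h⟩ := hT u hu x (mem_ball_self hρ)
    rw [nhdsWithin_eq_nhds.2 (ball_mem_nhds x hρ)] at ht
    exact ⟨t, mem_nhdsWithin_of_mem_nhds ht, h⟩

/-- The Fatou lemma along locally uniform convergence on an open set exhausted by the `W m`. -/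
lemma setLIntegral_enorm_sq_le_of_tendstoLocallyUniformlyOn {D : Set ℂ} (hD : IsOpen D)
    {ι : Type*} {l : Filter ι} [l.NeBot] {W : ι → Set ℂ} {g : ι → ℂ → ℂ} {f : ℂ → ℂ}
    (hW : ∀ m, MeasurableSet (W m)) (hWD : ∀ C, IsCompact C → C ⊆ D → ∀ᶠ m in l, C ⊆ W m)
    (hg : ∀ m, Measurable (g m)) (hgf : TendstoLocallyUniformlyOn g f l D) {M : ENNReal}
    (hM : ∀ m, ∫⁻ w in W m, ‖g m w‖ₑ ^ 2 ≤ M) : ∫⁻ w in D, ‖f w‖ₑ ^ 2 ≤ M := by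
  obtain ⟨K, hK, hKD, hKex⟩ := hD.exists_compact_exhaustion
  have hsel : ∀ k : ℕ, ∃ m, K k ⊆ W m ∧ ∀ w ∈ K k, dist (f w) (g m w) < 1 / (k + 1 : ℝ) := by
    intro k
    have hu := (tendstoLocallyUniformlyOn_iff_forall_isCompact hD).1 hgf (K k) (hKD k) (hK k)
    exact ((hWD (K k) (hK k) (hKD k)).and
      (Metric.tendstoUniformlyOn_iff.1 hu _ Nat.one_div_pos_of_nat)).exists
  choose φ hφW hφ using hsel
  have hpt : ∀ w ∈ D, Tendsto (fun k ↦ (W (φ k)).indicator (fun w ↦ ‖g (φ k) w‖ₑ ^ 2) w) atTop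
      (𝓝 (‖f w‖ₑ ^ 2)) := by
    intro w hw
    have hwK : ∀ᶠ k in atTop, w ∈ K k :=
      (hKex {w} isCompact_singleton (by simpa using hw)).mono fun k hk ↦ hk rfl
    have ht : Tendsto (fun k ↦ g (φ k) w) atTop (𝓝 (f w)) := by
      rw [tendsto_iff_dist_tendsto_zero]
      refine squeeze_zero' (.of_forall fun _ ↦ dist_nonneg) ?_
        tendsto_one_div_add_atTop_nhds_zero_nat
      filter_upwards [hwK] with k hk
      rw [dist_comm]
      exact (hφ k w hk).le
    refine Tendsto.congr' ?_ ((ENNReal.continuous_pow 2).tendsto _ |>.comp ht.enorm)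
    filter_upwards [hwK] with k hk
    rw [indicator_of_mem (hφW k hk)]
    rfl
  calc ∫⁻ w in D, ‖f w‖ₑ ^ 2
      = ∫⁻ w in D, liminf (fun k ↦ (W (φ k)).indicator (fun w ↦ ‖g (φ k) w‖ₑ ^ 2) w) atTop :=
        setLIntegral_congr_fun hD.measurableSet fun w hw ↦ (hpt w hw).liminf_eq.symm
    _ ≤ liminf (fun k ↦ ∫⁻ w in D, (W (φ k)).indicator (fun w ↦ ‖g (φ k) w‖ₑ ^ 2) w) atTop :=
        lintegral_liminf_le fun k ↦ ((hg _).enorm.pow_const 2).indicator (hW _)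
    _ ≤ liminf (fun _ : ℕ ↦ M) atTop := by
        refine liminf_le_liminf (.of_forall fun k ↦ ?_)
        refine (setLIntegral_le_lintegral _ _).trans ?_
        rw [lintegral_indicator (hW _)]
        exact hM _
    _ = M := liminf_const M

/-- The extremal lower bound at the origin: a substitute for the derivative of the Riemann map
together with the Koebe quarter theorem. -/
lemma exists_setLIntegral_enorm_sq_le_pi {D : Set ℂ} (hD : IsOpen D)
    (hb : Bornology.IsBounded D) (hc : IsConnected Dᶜ) {d : ℝ} (hd : 0 < d)
    (hball : ball (0 : ℂ) d ⊆ D) {a : ℂ} (ha : a ∉ D) (had : ‖a‖ = d) :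
    ∃ g : ℂ → ℂ, DifferentiableOn ℂ g D ∧ ‖g 0‖ = 1 / (4 * d) ∧
      ∫⁻ w in D, ‖g w‖ₑ ^ 2 ≤ ENNReal.ofReal Real.pi := by
  obtain ⟨K, hK, hKD, hKex⟩ := hD.exists_compact_exhaustion
  obtain ⟨R, -, hR, hRlim⟩ := exists_seq_strictMono_tendsto' (show 0 < 1 / (4 * d) by positivity)
  choose W F hWo hKW hWD hF hF1 hF0 hFint using fun m ↦
    exists_differentiableOn_norm_deriv_eq hD hb hc hd hball ha had (hK m) (hKD m) (hR m).1 (hR m).2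
  set U : Ultrafilter ℕ := hyperfilter ℕ
  have hU : (U : Filter ℕ) ≤ atTop := Nat.hyperfilter_le_atTop
  have hWex : ∀ C, IsCompact C → C ⊆ D → ∀ᶠ m in U, C ⊆ W m := fun C hC hCD ↦
    hU ((hKex C hC hCD).mono fun m hm ↦ hm.trans (hKW m))
  obtain ⟨f, hf, hlim⟩ := exists_tendstoLocallyUniformlyOn_deriv hD U hWex hF hF1
  refine ⟨deriv f, hf.deriv hD, ?_, ?_⟩
  · have h1 := (hlim.tendsto_at (hball (mem_ball_self hd))).norm
    simp_rw [hF0] at h1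
    exact tendsto_nhds_unique h1 (hRlim.mono_left hU)
  · exact setLIntegral_enorm_sq_le_of_tendstoLocallyUniformlyOn hD
      (fun m ↦ (hWo m).measurableSet) hWex (fun m ↦ measurable_deriv _) hlim hFint

lemma exists_setLIntegral_enorm_sq_le_one {D : Set ℂ} (hD : IsOpen D)
    (hb : Bornology.IsBounded D) (hc : IsConnected Dᶜ) {z : ℂ} {d : ℝ} (hd : 0 < d)
    (hball : ball z d ⊆ D) {a : ℂ} (ha : a ∉ D) (had : dist a z = d) :
    ∃ f : ℂ → ℂ, DifferentiableOn ℂ f D ∧ ∫⁻ w in D, ‖f w‖ₑ ^ 2 ≤ 1 ∧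
      1 / (16 * Real.pi * d ^ 2) ≤ ‖f z‖ ^ 2 := by
  set e : ℂ ≃ₜ ℂ := Homeomorph.addRight z
  obtain ⟨g, hg, hg0, hgint⟩ := exists_setLIntegral_enorm_sq_le_pi (D := e ⁻¹' D)
    (a := a - z) (hD.preimage e.continuous)
    (by
      have : e ⁻¹' D = (fun w ↦ w - z) '' D := by
        rw [← e.image_symm]; simp [e, Homeomorph.addRight, sub_eq_add_neg]
      rw [this]
      exact (LipschitzWith.id.sub (LipschitzWith.const z)).isBounded_image hb)
    (by rw [← preimage_compl]; exact e.isConnected_preimage.2 hc) hd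
    (fun w hw ↦ hball (by simpa [e] using hw)) (by simpa [e] using ha)
    (by rw [← dist_eq_norm]; exact had)
  refine ⟨fun w ↦ g (w - z) / (Real.sqrt Real.pi : ℂ), ?_, ?_, ?_⟩
  · refine DifferentiableOn.div_const (hg.comp (by fun_prop) fun w hw ↦ ?_) _
    simpa [e] using hw
  · have hmp : MeasurePreserving e volume volume := measurePreserving_add_right volume z
    have hcv := hmp.setLIntegral_comp_preimage_emb e.measurableEmbedding
      (fun w ↦ ‖g (w - z) / (Real.sqrt Real.pi : ℂ)‖ₑ ^ 2) D
    rw [← hcv]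
    have hpt : ∀ w, ‖g (e w - z) / (Real.sqrt Real.pi : ℂ)‖ₑ ^ 2 =
        (ENNReal.ofReal Real.pi)⁻¹ * ‖g w‖ₑ ^ 2 := by
      intro w
      have hw : e w - z = w := by simp [e]
      have hpi : (Real.sqrt Real.pi : ℂ) ≠ 0 :=
        Complex.ofReal_ne_zero.2 (Real.sqrt_pos.2 Real.pi_pos).ne'
      rw [hw, div_eq_inv_mul, enorm_mul, mul_pow, enorm_inv hpi, ← ENNReal.inv_pow,
        ← enorm_pow, ← Complex.ofReal_pow, Real.sq_sqrt Real.pi_pos.le]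
      congr 2
      rw [← ofReal_norm, Complex.norm_real, Real.norm_of_nonneg Real.pi_pos.le]
    simp_rw [hpt]
    rw [lintegral_const_mul' _ _ (by simp [Real.pi_pos])]
    refine (mul_le_mul_right hgint _).trans ?_
    rw [ENNReal.inv_mul_cancel (by simp [Real.pi_pos]) (by simp)]
  · simp only [sub_self, norm_div, Complex.norm_real, hg0,
      Real.norm_of_nonneg (Real.sqrt_nonneg Real.pi)]
    rw [div_pow, Real.sq_sqrt Real.pi_pos.le]
    apply le_of_eq
    field_simp
    norm_num

/-- Estimates for the diagonal of the Bergman kernel of a Jordan domain: for `z ∈ D` with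
`d = dist(z, ∂D)`, every holomorphic `f` on `D` with `∫_D |f|² dA ≤ 1` satisfies
`|f(z)|² ≤ 1/(π d²)`, and some such `f` satisfies `|f(z)|² ≥ 1/(16 π d²)`. -/
theorem stmt4 (D : Set ℂ) (hD : IsJordanDomain D) (z : ℂ) (hz : z ∈ D)
    (d : ℝ) (hd : d = infDist z (frontier D)) :
    (∀ f : ℂ → ℂ, DifferentiableOn ℂ f D →
      (∫⁻ w in D, (‖f w‖₊ : ENNReal) ^ 2) ≤ 1 →
      ‖f z‖ ^ 2 ≤ 1 / (Real.pi * d ^ 2)) ∧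
    ∃ f : ℂ → ℂ, DifferentiableOn ℂ f D ∧
      (∫⁻ w in D, (‖f w‖₊ : ENNReal) ^ 2) ≤ 1 ∧
      1 / (16 * Real.pi * d ^ 2) ≤ ‖f z‖ ^ 2 := by
  have hDo : IsOpen D := hD.isOpen
  have hne : (frontier D).Nonempty := by
    refine nonempty_frontier_iff.2 ⟨⟨z, hz⟩, fun h ↦ ?_⟩
    obtain ⟨w, hw⟩ := hD.isConnected_compl.nonempty
    exact hw (h ▸ mem_univ w)
  obtain ⟨a, haf, hda⟩ := isClosed_frontier.exists_infDist_eq_dist hne z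
  rw [← hd] at hda
  have haD : a ∉ D := (hDo.frontier_eq ▸ haf).2
  have hd0 : 0 < d := by
    rw [hda, dist_pos]; rintro rfl; exact haD hz
  have hball : ball z d ⊆ D := by
    refine (convex_ball z d).isPreconnected.subset_of_closure_inter_subset hDo
      ⟨z, mem_ball_self hd0, hz⟩ fun y hy ↦ ?_
    by_contra hyD
    have hyf : y ∈ frontier D := by rw [hDo.frontier_eq]; exact ⟨hy.1, hyD⟩
    have hyd := hy.2
    rw [mem_ball, dist_comm, hd] at hyd
    exact (infDist_le_dist_of_mem hyf).not_gt hyd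
  refine ⟨fun f hf hint ↦ ?_, exists_setLIntegral_enorm_sq_le_one hDo hD.isBounded
    hD.isConnected_compl hd0 hball haD (by rw [dist_comm]; exact hda.symm)⟩
  have h1 : ENNReal.ofReal (Real.pi * d ^ 2) * ‖f z‖ₑ ^ 2 ≤ 1 :=
    ((setLIntegral_enorm_sq_ball_ge hd0 (hf.mono hball)).trans
      (lintegral_mono_set hball)).trans hint
  rw [← ofReal_norm, ← ENNReal.ofReal_pow (norm_nonneg _),
    ← ENNReal.ofReal_mul (by positivity), ENNReal.ofReal_le_one] at h1
  rwa [le_div_iff₀ (by positivity), mul_comm]
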